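/- arXiv:1401.4650 — 2 statements merged into one kernel-verified Lean document; each statement's English description precedes it below -/
import Mathlib

section
/- For every q ≥ 2, n ≥ 4 and 2 ≤ k ≤ n−2, any two consecutive words of the list S_{n,q}^{(k)} = 0^k·H_{n−k,q}^{(k)} have Hamming distance exactly 1, i.e., they differ in exactly one position. -/
/-- Hamming distance between two words (of the same length): number of differing positions. -/
def hamming (a b : List ℕ) : ℕ :=
  ((a.zip b).filter (fun p => p.1 ≠ p.2)).length

/-- The generalized reflected Gray code list `G_{n,q}` over the alphabet `{1,…,q-1}`. -/
def G (q : ℕ) : ℕ → List (List ℕ)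
  | 0 => [[]]
  | n + 1 =>
    (List.range (q - 1)).flatMap (fun j =>
      (if (j + 1) % 2 = 1 then G q n else (G q n).reverse).map (fun w => (j + 1) :: w))

/-- Replace the 1's of a binary word (first arg), read from left to right,
by the letters of the second word. -/
def subst : List ℕ → List ℕ → List ℕ
  | [], _ => []
  | 0 :: β, w => 0 :: subst β w
  | _ :: β, w => w.headD 0 :: subst β w.tail

/-- The expansion `ε(β)` of a binary word `β` w.r.t. the alphabet `{0,…,q-1}`. -/
def expand (q : ℕ) (β : List ℕ) : List (List ℕ) :=
  (G q (β.count 1)).map (fun w => subst β w)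

/-- The trace of a word: replace every nonzero letter by 1. -/
def trace (w : List ℕ) : List ℕ := w.map (fun x => if x = 0 then 0 else 1)

/-- The modified binary reflected Gray code list `C_n`. -/
def C : ℕ → List (List ℕ)
  | 0 => [[]]
  | n + 1 => (C n).reverse.map (fun w => 1 :: w) ++ (C n).map (fun w => 0 :: w)

/-- The Gray code list `F_n^{(k)}` of length-`n` binary words avoiding `k` consecutive 0's. -/
def F (k n : ℕ) : List (List ℕ) :=
  if h : n < k then C n
  else (List.range k).attach.flatMap (fun ℓ =>
    ((F k (n - 1 - ℓ.1)).reverse).map (fun w => List.replicate ℓ.1 0 ++ 1 :: w))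
termination_by n
decreasing_by
  have := List.mem_range.mp ℓ.2
  omega

/-- The list `H_{n,q}^{(k)}`. -/
def H (q k n : ℕ) : List (List ℕ) :=
  ((F k (n - 2)).zipIdx).flatMap (fun p =>
    if p.2 % 2 = 0 then expand q (1 :: (p.1 ++ [1]))
    else (expand q (1 :: (p.1 ++ [1]))).reverse)

/-- The list `S_{n,q}^{(k)}`. -/
def S (q k n : ℕ) : List (List ℕ) :=
  (H q k (n - k)).map (fun w => List.replicate k 0 ++ w)

/-- The `k`-Fibonacci numbers. -/
def kfib (k n : ℕ) : ℕ :=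
  if n < k then 2 ^ n
  else ∑ i ∈ (Finset.range k).attach, kfib k (n - 1 - i.1)
termination_by n
decreasing_by
  have := Finset.mem_range.mp i.2
  omega

/-- The list `F_n^{(k)}(u)` (second recursive definition). -/
def Faux (k : ℕ) : ℕ → ℕ → List (List ℕ)
  | 0, _ => [[]]
  | n + 1, 0 => (Faux k n (k - 1)).reverse.map (fun w => 1 :: w)
  | n + 1, u + 1 =>
    (Faux k n (k - 1)).reverse.map (fun w => 1 :: w) ++ (Faux k n u).map (fun w => 0 :: w)



def RR (a b : List ℕ) : Prop := a.length = b.length ∧ hamming a b = 1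

theorem hamming_cons (x y : ℕ) (a b : List ℕ) :
    hamming (x :: a) (y :: b) = (if x = y then 0 else 1) + hamming a b := by
  unfold hamming
  by_cases h : x = y <;> simp [h]
  omega

theorem hamming_nil : hamming [] [] = 0 := rfl

theorem hamming_self (a : List ℕ) : hamming a a = 0 := by
  induction a with
  | nil => rfl
  | cons x a ih => simp [hamming_cons, ih]

theorem hamming_comm : ∀ (a b : List ℕ), hamming a b = hamming b a
  | [], [] => rfl
  | [], _ :: _ => rfl
  | _ :: _, [] => rfl
  | x :: a, y :: b => by
    simp only [hamming_cons, hamming_comm a b, eq_comm]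

theorem RR_symm {a b : List ℕ} (h : RR a b) : RR b a :=
  ⟨h.1.symm, by rw [hamming_comm]; exact h.2⟩

theorem RR_cons {a b : List ℕ} (x : ℕ) (h : RR a b) : RR (x :: a) (x :: b) :=
  ⟨by simp [h.1], by simp [hamming_cons, h.2]⟩

theorem RR_cons_ne {x y : ℕ} (a : List ℕ) (h : x ≠ y) : RR (x :: a) (y :: a) :=
  ⟨by simp, by simp [hamming_cons, h, hamming_self]⟩

theorem RR_append_left {a b : List ℕ} (u : List ℕ) (h : RR a b) : RR (u ++ a) (u ++ b) := by
  induction u with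
  | nil => exact h
  | cons x u ih => exact RR_cons x ih

theorem hamming_append_right : ∀ (a b u : List ℕ), a.length = b.length →
    hamming (a ++ u) (b ++ u) = hamming a b
  | [], [], u, _ => by simp [hamming_self, hamming_nil]
  | [], _ :: _, _, h => by simp at h
  | _ :: _, [], _, h => by simp at h
  | x :: a, y :: b, u, h => by
    simp only [List.cons_append, hamming_cons]
    rw [hamming_append_right a b u (by simpa using h)]

theorem RR_append_right {a b : List ℕ} (u : List ℕ) (h : RR a b) : RR (a ++ u) (b ++ u) :=
  ⟨by simp [h.1], by rw [hamming_append_right _ _ _ h.1]; exact h.2⟩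

theorem chain_reverse {l : List (List ℕ)} (h : l.IsChain RR) : l.reverse.IsChain RR := by
  rw [List.isChain_reverse]
  exact h.imp fun _ _ => RR_symm

theorem chain_map {l : List (List ℕ)} (f : List ℕ → List ℕ) (hf : ∀ a b, RR a b → RR (f a) (f b))
    (h : l.IsChain RR) : (l.map f).IsChain RR := by
  rw [List.isChain_map]
  exact h.imp fun _ _ => hf _ _

theorem chain_range_flatMap (f : ℕ → List (List ℕ)) (m : ℕ)
    (hne : ∀ j < m, f j ≠ []) (hc : ∀ j < m, (f j).IsChain RR)
    (hl : ∀ j, j + 1 < m → ∀ x ∈ (f j).getLast?, ∀ y ∈ (f (j + 1)).head?, RR x y) :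
    ((List.range m).flatMap f).IsChain RR := by
  induction m with
  | zero => simp
  | succ m ih =>
    rw [List.range_succ, List.flatMap_append, List.isChain_append]
    refine ⟨ih (fun j hj => hne j (by omega)) (fun j hj => hc j (by omega))
      (fun j hj => hl j (by omega)), by simpa using hc m (by omega), ?_⟩
    intro x hx y hy
    cases m with
    | zero => simp at hx
    | succ m =>
      rw [List.range_succ, List.flatMap_append, List.flatMap_singleton,
        List.getLast?_append_of_ne_nil _ (hne m (by omega))] at hx
      rw [List.flatMap_singleton] at hy
      exact hl m (by omega) x hx y hy

theorem range_flatMap_last (f : ℕ → List (List ℕ)) (m : ℕ) (hne : f m ≠ []) :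
    ((List.range (m + 1)).flatMap f).getLast? = (f m).getLast? := by
  rw [List.range_succ, List.flatMap_append, List.flatMap_singleton,
    List.getLast?_append_of_ne_nil _ hne]

theorem range_flatMap_head (f : ℕ → List (List ℕ)) (m : ℕ) (hne : f 0 ≠ []) :
    ((List.range (m + 1)).flatMap f).head? = (f 0).head? := by
  rw [List.range_succ_eq_map, List.flatMap_cons, List.head?_append_of_ne_nil _ hne]

/-! Properties of `G`. -/

theorem G_len (q : ℕ) : ∀ t, ∀ w ∈ G q t, w.length = t
  | 0, w, h => by simp [G] at h; simp [h]
  | t + 1, w, h => by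
    simp only [G, List.mem_flatMap, List.mem_map] at h
    obtain ⟨j, _, v, hv, rfl⟩ := h
    have : v ∈ G q t := by split_ifs at hv <;> simpa using hv
    simp [G_len q t v this]

theorem G_head (q : ℕ) (hq : 2 ≤ q) : ∀ t, (G q t).head? = some (List.replicate t 1)
  | 0 => by simp [G]
  | t + 1 => by
    obtain ⟨m, hm⟩ : ∃ m, q - 1 = m + 1 := ⟨q - 2, by omega⟩
    have ih := G_head q hq t
    have hne : G q t ≠ [] := by intro h; simp [h] at ih
    simp only [G, hm]
    rw [range_flatMap_head _ _ (by simpa using hne)]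
    simp [List.head?_map, ih, List.replicate_succ]

theorem G_ne (q : ℕ) (hq : 2 ≤ q) (t : ℕ) : G q t ≠ [] := by
  intro h; have := G_head q hq t; simp [h] at this

theorem G_last_step (q : ℕ) (hq : 2 ≤ q) (t : ℕ) : (G q (t + 1)).getLast? =
    (if (q - 1) % 2 = 1 then (G q t).getLast? else (G q t).head?).map (fun w => (q - 1) :: w) := by
  obtain ⟨m, hm⟩ : ∃ m, q - 1 = m + 1 := ⟨q - 2, by omega⟩
  have hne := G_ne q hq t
  simp only [G, hm]
  rw [range_flatMap_last _ _ (by split_ifs <;> simpa using hne)]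
  split_ifs <;> simp [List.getLast?_map]

theorem G_last (q : ℕ) (hq : 2 ≤ q) : ∃ c, c ≠ 0 ∧ ∀ t, (G q (t + 1)).getLast? =
    some ((q - 1) :: List.replicate t c) := by
  by_cases h : (q - 1) % 2 = 1
  · refine ⟨q - 1, by omega, fun t => ?_⟩
    induction t with
    | zero => rw [G_last_step q hq]; simp [G]
    | succ t ih => rw [G_last_step q hq, if_pos h, ih]; simp [List.replicate_succ]
  · refine ⟨1, by omega, fun t => ?_⟩
    rw [G_last_step q hq, if_neg h, G_head q hq]; simp

theorem G_chain (q : ℕ) (hq : 2 ≤ q) : ∀ t, (G q t).IsChain RR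
  | 0 => by simp [G]
  | t + 1 => by
    have ih := G_chain q hq t
    have hne := G_ne q hq t
    simp only [G]
    apply chain_range_flatMap
    · intro j _; split_ifs <;> simpa using hne
    · intro j _
      apply chain_map _ (fun a b h => RR_cons _ h)
      split_ifs
      · exact ih
      · exact chain_reverse ih
    · intro j _ x hx y hy
      have key : ∃ w, x = (j + 1) :: w ∧ y = (j + 1 + 1) :: w := by
        by_cases h : (j + 1) % 2 = 1
        · have h' : ¬ ((j + 1 + 1) % 2 = 1) := by omega
          rw [if_pos h] at hx
          rw [if_neg h'] at hy
          simp only [List.getLast?_map, List.head?_map, List.head?_reverse, Option.mem_def,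
            Option.map_eq_some_iff] at hx hy
          obtain ⟨w, hw, rfl⟩ := hx
          obtain ⟨w', hw', rfl⟩ := hy
          rw [hw] at hw'
          cases hw'
          exact ⟨w, rfl, rfl⟩
        · have h' : ((j + 1 + 1) % 2 = 1) := by omega
          rw [if_neg h] at hx
          rw [if_pos h'] at hy
          simp only [List.getLast?_map, List.head?_map, List.getLast?_reverse, Option.mem_def,
            Option.map_eq_some_iff] at hx hy
          obtain ⟨w, hw, rfl⟩ := hx
          obtain ⟨w', hw', rfl⟩ := hy
          rw [hw] at hw'
          cases hw'
          exact ⟨w, rfl, rfl⟩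
      obtain ⟨w, rfl, rfl⟩ := key
      exact RR_cons_ne w (by omega)

/-! Properties of `subst` and `expand`. -/

def Bin (β : List ℕ) : Prop := ∀ x ∈ β, x = 0 ∨ x = 1

theorem subst_RR : ∀ (β v w : List ℕ), Bin β → v.length = β.count 1 → w.length = β.count 1 →
    hamming (subst β v) (subst β w) = hamming v w
  | [], v, w, _, hv, hw => by
    simp at hv hw; subst hv hw; rfl
  | x :: β, v, w, hb, hv, hw => by
    have hb' : Bin β := fun y hy => hb y (by simp [hy])
    rcases hb x (by simp) with rfl | rfl
    · simp only [_root_.subst, hamming_cons]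
      rw [subst_RR β v w hb' (by simpa using hv) (by simpa using hw)]
      simp
    · cases v with
      | nil => simp at hv
      | cons a v =>
        cases w with
        | nil => simp at hw
        | cons b w =>
          simp only [_root_.subst, hamming_cons, List.headD_cons, List.tail_cons]
          rw [subst_RR β v w hb' (by simpa using hv) (by simpa using hw)]

theorem subst_length : ∀ (β v : List ℕ), (subst β v).length = β.length
  | [], v => rfl
  | 0 :: β, v => by simp [_root_.subst, subst_length β]
  | (x + 1) :: β, v => by simp [_root_.subst, subst_length β]

theorem subst_replicate (c : ℕ) : ∀ (β : List ℕ), Bin β →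
    subst β (List.replicate (β.count 1) c) = β.map (fun x => if x = 0 then 0 else c)
  | [], _ => rfl
  | x :: β, hb => by
    have hb' : Bin β := fun y hy => hb y (by simp [hy])
    have ih := subst_replicate c β hb'
    rcases hb x (by simp) with rfl | rfl
    · simp [_root_.subst, ih]
    · simp [_root_.subst, ih, List.replicate_succ]

theorem hamming_map (c : ℕ) (hc : c ≠ 0) : ∀ (a b : List ℕ), Bin a → Bin b →
    hamming (a.map (fun x => if x = 0 then 0 else c)) (b.map (fun x => if x = 0 then 0 else c))
      = hamming a b
  | [], [], _, _ => rfl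
  | [], _ :: _, _, _ => rfl
  | _ :: _, [], _, _ => rfl
  | x :: a, y :: b, ha, hb => by
    have ha' : Bin a := fun y hy => ha y (by simp [hy])
    have hb' : Bin b := fun y hy => hb y (by simp [hy])
    simp only [List.map_cons, hamming_cons]
    rw [hamming_map c hc a b ha' hb']
    rcases ha x (by simp) with rfl | rfl <;> rcases hb y (by simp) with rfl | rfl <;>
      simp [hc, Ne.symm hc]

theorem RR_map (c : ℕ) (hc : c ≠ 0) {a b : List ℕ} (ha : Bin a) (hb : Bin b) (h : RR a b) :
    RR (a.map (fun x => if x = 0 then 0 else c)) (b.map (fun x => if x = 0 then 0 else c)) :=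
  ⟨by simp [h.1], by rw [hamming_map c hc a b ha hb]; exact h.2⟩

theorem chain_with_mem {l : List (List ℕ)} (P : List ℕ → Prop) (hP : ∀ a ∈ l, P a)
    (h : l.IsChain RR) : l.IsChain (fun a b => RR a b ∧ P a ∧ P b) := by
  induction h with
  | nil => simp
  | singleton => simp
  | cons_cons h1 h2 ih =>
    refine List.IsChain.cons_cons ⟨h1, hP _ (by simp), hP _ (by simp)⟩
      (ih fun a ha => hP a (List.mem_cons_of_mem _ ha))

theorem expand_chain (q : ℕ) (hq : 2 ≤ q) (β : List ℕ) (hb : Bin β) :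
    (expand q β).IsChain RR := by
  unfold expand
  rw [List.isChain_map]
  refine (chain_with_mem _ (G_len q _) (G_chain q hq (β.count 1))).imp ?_
  rintro a b ⟨h, h1, h2⟩
  exact ⟨by simp [subst_length], by rw [subst_RR β a b hb h1 h2]; exact h.2⟩

theorem expand_ne (q : ℕ) (hq : 2 ≤ q) (β : List ℕ) : expand q β ≠ [] := by
  simpa [expand] using G_ne q hq _

theorem expand_head (q : ℕ) (hq : 2 ≤ q) (β : List ℕ) (hb : Bin β) :
    (expand q β).head? = some (β.map (fun x => if x = 0 then 0 else 1)) := by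
  unfold expand
  rw [List.head?_map, G_head q hq, Option.map_some, subst_replicate 1 β hb]

theorem expand_last (q : ℕ) (hq : 2 ≤ q) : ∃ c, c ≠ 0 ∧ ∀ β, Bin β →
    (expand q (1 :: β)).getLast? = some ((q - 1) :: β.map (fun x => if x = 0 then 0 else c)) := by
  obtain ⟨c, hc, h⟩ := G_last q hq
  refine ⟨c, hc, fun β hb => ?_⟩
  unfold expand
  rw [List.getLast?_map, List.count_cons_self, h, Option.map_some]
  simp [_root_.subst, subst_replicate c β hb]

/-! Properties of `C` and `F`. -/

theorem C_ne : ∀ n, C n ≠ []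
  | 0 => by simp [C]
  | n + 1 => by simp [C, C_ne n]

theorem C_bin : ∀ n, ∀ w ∈ C n, Bin w
  | 0, w, h => by simp [C] at h; simp [h, Bin]
  | n + 1, w, h => by
    have ih := C_bin n
    simp only [C, List.mem_append, List.mem_map, List.mem_reverse] at h
    rcases h with ⟨v, hv, rfl⟩ | ⟨v, hv, rfl⟩ <;> intro x hx <;>
      rcases List.mem_cons.1 hx with rfl | hx
    · simp
    · exact ih v hv x hx
    · simp
    · exact ih v hv x hx

theorem C_chain : ∀ n, (C n).IsChain RR
  | 0 => by simp [C]
  | n + 1 => by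
    have ih := C_chain n
    simp only [C]
    rw [List.isChain_append]
    refine ⟨chain_map _ (fun a b h => RR_cons _ h) (chain_reverse ih),
      chain_map _ (fun a b h => RR_cons _ h) ih, ?_⟩
    intro x hx y hy
    simp only [List.getLast?_map, List.head?_map, List.getLast?_reverse, Option.mem_def,
      Option.map_eq_some_iff] at hx hy
    obtain ⟨w, hw, rfl⟩ := hx
    obtain ⟨w', hw', rfl⟩ := hy
    rw [hw] at hw'
    cases hw'
    exact RR_cons_ne w (by omega)

theorem F_lt {k n : ℕ} (h : n < k) : F k n = C n := by
  rw [F, dif_pos h]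

theorem F_ge {k n : ℕ} (h : ¬ n < k) : F k n = (List.range k).flatMap (fun l =>
    ((F k (n - 1 - l)).reverse).map (fun w => List.replicate l 0 ++ 1 :: w)) := by
  rw [F, dif_neg h]
  simp only [List.flatMap_def]
  congr 1
  exact List.attach_map_val (l := List.range k) (f := fun l =>
    ((F k (n - 1 - l)).reverse).map (fun w => List.replicate l 0 ++ 1 :: w))

theorem F_ne (k : ℕ) (hk : 2 ≤ k) (n : ℕ) : F k n ≠ [] := by
  induction n using Nat.strong_induction_on with
  | _ n ih =>
    by_cases h : n < k
    · rw [F_lt h]; exact C_ne n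
    · rw [F_ge h]
      intro h0
      rw [List.flatMap_eq_nil_iff] at h0
      have := h0 0 (by simp; omega)
      simp at this
      exact ih (n - 1) (by omega) this

theorem F_bin (k n : ℕ) : ∀ w ∈ F k n, Bin w := by
  induction n using Nat.strong_induction_on with
  | _ n ih =>
    by_cases h : n < k
    · rw [F_lt h]; exact C_bin n
    · rw [F_ge h]
      intro w hw x hx
      simp only [List.mem_flatMap, List.mem_map, List.mem_reverse, List.mem_range] at hw
      obtain ⟨l, hl, v, hv, rfl⟩ := hw
      simp only [List.mem_append, List.mem_cons, List.mem_replicate] at hx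
      rcases hx with ⟨_, rfl⟩ | rfl | hx
      · simp
      · simp
      · exact ih _ (by omega) v hv x hx

theorem F_head (k : ℕ) (hk : 2 ≤ k) (m : ℕ) :
    (F k (m + 1)).head? = (F k m).getLast?.map (fun w => 1 :: w) := by
  by_cases h : m + 1 < k
  · rw [F_lt h, F_lt (by omega), C, List.head?_append_of_ne_nil _ (by simp [C_ne])]
    simp
  · obtain ⟨j, rfl⟩ : ∃ j, k = j + 1 := ⟨k - 1, by omega⟩
    rw [F_ge h, range_flatMap_head _ _ (by simp [F_ne _ hk])]
    simp

theorem F_chain (k : ℕ) (hk : 2 ≤ k) (n : ℕ) : (F k n).IsChain RR := by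
  induction n using Nat.strong_induction_on with
  | _ n ih =>
    by_cases h : n < k
    · rw [F_lt h]; exact C_chain n
    · rw [F_ge h]
      apply chain_range_flatMap
      · intro j _; simp [F_ne k hk]
      · intro j hj
        exact chain_map _ (fun a b h => RR_append_left _ (RR_cons 1 h))
          (chain_reverse (ih _ (by omega)))
      · intro j hj x hx y hy
        obtain ⟨m, hm⟩ : ∃ m, n - 1 - j = m + 1 := ⟨n - 1 - j - 1, by omega⟩
        have hm' : n - 1 - (j + 1) = m := by omega
        rw [hm] at hx
        rw [hm'] at hy
        simp only [List.getLast?_map, List.head?_map, List.getLast?_reverse, List.head?_reverse,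
          F_head k hk, Option.mem_def, Option.map_eq_some_iff] at hx hy
        obtain ⟨w, ⟨v, hv, rfl⟩, rfl⟩ := hx
        obtain ⟨w', hw', rfl⟩ := hy
        rw [hv] at hw'
        cases hw'
        rw [List.replicate_succ', List.append_assoc]
        exact RR_append_left _ (RR_cons_ne _ (by omega))

/-! The list `H`. -/

theorem zip_chain (q : ℕ) (hq : 2 ≤ q) (L : List (List ℕ)) (hc : L.IsChain RR)
    (hb : ∀ w ∈ L, Bin w) (s : ℕ) :
    ((L.zipIdx s).flatMap (fun p =>
    if p.2 % 2 = 0 then expand q (1 :: (p.1 ++ [1]))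
    else (expand q (1 :: (p.1 ++ [1]))).reverse)).IsChain RR := by
  have bin1 : ∀ w, Bin w → Bin (w ++ [1]) := by
    intro w hw x hx
    rcases List.mem_append.1 hx with hx | hx
    · exact hw x hx
    · simp at hx; simp [hx]
  have bin2 : ∀ w, Bin w → Bin (1 :: (w ++ [1])) := by
    intro w hw x hx
    rcases List.mem_cons.1 hx with hx | hx
    · simp [hx]
    · exact bin1 w hw x hx
  obtain ⟨c, hc0, hlast⟩ := expand_last q hq
  induction L generalizing s with
  | nil => simp
  | cons a L ih =>
    rw [List.zipIdx_cons, List.flatMap_cons, List.isChain_append]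
    have ha : Bin a := hb a (by simp)
    refine ⟨?_, ih hc.tail (fun w hw => hb w (by simp [hw])) _, ?_⟩
    · split_ifs
      · exact expand_chain q hq _ (bin2 a ha)
      · exact chain_reverse (expand_chain q hq _ (bin2 a ha))
    · intro x hx y hy
      cases L with
      | nil => simp at hy
      | cons b L =>
        have hbb : Bin b := hb b (by simp)
        have hab : RR (a ++ [1]) (b ++ [1]) :=
          RR_append_right _ (List.isChain_cons_cons.1 hc).1
        rw [List.zipIdx_cons, List.flatMap_cons, List.head?_append_of_ne_nil _ (by
          split_ifs <;> simp [expand_ne q hq])] at hy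
        by_cases h : s % 2 = 0
        · have h' : ¬ (s + 1) % 2 = 0 := by omega
          simp only [h, h', if_true, if_false, List.head?_reverse] at hx hy
          rw [hlast _ (bin1 _ ha)] at hx
          rw [hlast _ (bin1 _ hbb)] at hy
          cases hx; cases hy
          exact RR_cons _ (RR_map c hc0 (bin1 _ ha) (bin1 _ hbb) hab)
        · have h' : (s + 1) % 2 = 0 := by omega
          simp only [h, h', if_true, if_false, List.getLast?_reverse] at hx hy
          rw [expand_head q hq _ (bin2 _ ha)] at hx
          rw [expand_head q hq _ (bin2 _ hbb)] at hy
          cases hx; cases hy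
          exact RR_map 1 (by omega) (bin2 _ ha) (bin2 _ hbb) (RR_cons _ hab)

/-- For every `q ≥ 2`, `n ≥ 4` and `2 ≤ k ≤ n-2`, any two consecutive words of
`S_{n,q}^{(k)} = 0^k · H_{n-k,q}^{(k)}` differ in exactly one position. -/
theorem stmt_16 (q k n : ℕ) (hq : 2 ≤ q) (hn : 4 ≤ n) (hk : 2 ≤ k) (hkn : k ≤ n - 2)
    (i : ℕ) (a b : List ℕ)
    (ha : (S q k n)[i]? = some a) (hb : (S q k n)[i + 1]? = some b) :
    hamming a b = 1 := by
  have hS : (S q k n).IsChain RR := by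
    unfold S H
    exact chain_map _ (fun a b h => RR_append_left _ h)
      (zip_chain q hq _ (F_chain k hk _) (F_bin k _) 0)
  rw [List.getElem?_eq_some_iff] at ha hb
  obtain ⟨h1, rfl⟩ := ha
  obtain ⟨h2, rfl⟩ := hb
  exact (List.isChain_iff_getElem.1 hS i h2).2
end

section
/- For every q ≥ 2, n ≥ 4 and 2 ≤ k ≤ n−2, the list S_{n,q}^{(k)} = 0^k·H_{n−k,q}^{(k)} contains exactly once each word s_1s_2⋯s_n over the alphabet {0,1,…,q−1} satisfying: s_1 = s_2 = ⋯ = s_k = 0, s_{k+1} ≠ 0, s_n ≠ 0, and the subword s_{k+2}⋯s_{n−1} does not contain k consecutive 0's; and it contains no other words. Moreover, this list is trace partitioned: for every binary word τ of length n, the words of the list S_{n,q}^{(k)} whose trace equals τ occupy a set of consecutive positions in the list. -/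
theorem G_mem (q n : ℕ) (w : List ℕ) :
    w ∈ G q n ↔ w.length = n ∧ ∀ x ∈ w, x ≠ 0 ∧ x < q := by
  induction n generalizing w with
  | zero => 
    simp only [G, List.mem_singleton, List.length_eq_zero_iff]
    constructor
    · rintro rfl; simp
    · exact fun h => h.1
  | succ n ih =>
    have key : ∀ (j : ℕ) (w : List ℕ), (w ∈ (if (j + 1) % 2 = 1 then G q n else (G q n).reverse)) ↔
        w ∈ G q n := by
      intro j w; split_ifs <;> simp
    simp only [G, List.mem_flatMap, List.mem_map, key, ih, List.mem_range]
    constructor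
    · rintro ⟨j, hj, u, ⟨h1, h2⟩, rfl⟩
      refine ⟨by simp [h1], ?_⟩
      intro x hx
      rcases List.mem_cons.1 hx with rfl | hx
      · omega
      · exact h2 x hx
    · rintro ⟨h1, h2⟩
      cases w with
      | nil => simp at h1
      | cons a u =>
        have ha := h2 a (by simp)
        refine ⟨a - 1, by omega, u, ⟨by simpa using h1, fun x hx => h2 x (by simp [hx])⟩, ?_⟩
        rw [Nat.sub_add_cancel (by omega)]

theorem G_nodup (q n : ℕ) : (G q n).Nodup := by
  induction n with
  | zero => simp [G]
  | succ n ih =>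
    simp only [G]
    rw [List.nodup_flatMap]
    constructor
    · intro j _
      apply List.Nodup.map
      · intro a b h; simpa using h
      · split_ifs
        · exact ih
        · exact List.nodup_reverse.2 ih
    · refine List.Pairwise.imp ?_ (List.nodup_range (n := q - 1))
      intro a b hab
      simp only [Function.onFun, List.disjoint_left, List.mem_map]
      rintro x ⟨u, _, rfl⟩ ⟨v, _, h⟩
      simp at h
      omega

theorem C_mem (n : ℕ) (w : List ℕ) :
    w ∈ C n ↔ w.length = n ∧ ∀ x ∈ w, x < 2 := by
  induction n generalizing w with
  | zero =>
    simp only [C, List.mem_singleton, List.length_eq_zero_iff]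
    constructor
    · rintro rfl; simp
    · exact fun h => h.1
  | succ n ih =>
    simp only [C, List.mem_append, List.mem_map, List.mem_reverse, ih]
    constructor
    · rintro (⟨u, ⟨h1, h2⟩, rfl⟩ | ⟨u, ⟨h1, h2⟩, rfl⟩) <;> simp [h1] <;> exact fun a ha => Nat.le_of_lt_succ (h2 a ha)
    · rintro ⟨h1, h2⟩
      cases w with
      | nil => simp at h1
      | cons a u =>
        have ha := h2 a (by simp)
        have h3 : u.length = n ∧ ∀ x ∈ u, x < 2 :=
          ⟨by simpa using h1, fun x hx => h2 x (by simp [hx])⟩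
        interval_cases a
        · exact Or.inr ⟨u, h3, rfl⟩
        · exact Or.inl ⟨u, h3, rfl⟩

theorem C_nodup (n : ℕ) : (C n).Nodup := by
  induction n with
  | zero => simp [C]
  | succ n ih =>
    simp only [C]
    apply List.Nodup.append
    · exact List.Nodup.map (fun a b h => by simpa using h) (List.nodup_reverse.2 ih)
    · exact List.Nodup.map (fun a b h => by simpa using h) ih
    · simp only [List.disjoint_left, List.mem_map]
      rintro x ⟨u, _, rfl⟩ ⟨v, _, h⟩
      simp at h

theorem rep_inj (a b : ℕ) (u v : List ℕ)
    (h : List.replicate a 0 ++ 1 :: u = List.replicate b 0 ++ 1 :: v) : a = b ∧ u = v := by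
  induction a generalizing b with
  | zero => cases b <;> simp_all [List.replicate_succ]
  | succ a ih =>
    cases b with
    | zero => simp [List.replicate_succ] at h
    | succ b =>
      simp only [List.replicate_succ, List.cons_append, List.cons.injEq, true_and] at h
      have := ih b h
      exact ⟨by rw [this.1], this.2⟩

theorem avoid_iff (k l : ℕ) (hl : l < k) (u : List ℕ) :
    List.replicate k 0 <:+: (List.replicate l 0 ++ 1 :: u) ↔ List.replicate k 0 <:+: u := by
  have hp : ∀ l < k, ¬ (List.replicate k 0 <+: (List.replicate l 0 ++ 1 :: u)) := by
    intro l hl h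
    obtain ⟨m, rfl⟩ : ∃ m, k = l + (m + 1) := ⟨k - l - 1, by omega⟩
    rw [List.replicate_add, List.prefix_append_right_inj, List.replicate_succ,
      List.cons_prefix_cons] at h
    exact absurd h.1 (by norm_num)
  induction l with
  | zero =>
    have := hp 0 hl
    simp only [List.replicate_zero, List.nil_append] at this ⊢
    rw [List.infix_cons_iff]
    tauto
  | succ l ih =>
    have := hp (l + 1) hl
    have ih2 := ih (by omega)
    refine Iff.trans ?_ ih2
    simp only [List.replicate_succ (n := l), List.cons_append] at this ⊢
    rw [List.infix_cons_iff]
    tauto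

theorem bin_decomp (w : List ℕ) (h : ∀ x ∈ w, x < 2) :
    w = List.replicate w.length 0 ∨ ∃ l u, w = List.replicate l 0 ++ 1 :: u := by
  induction w with
  | nil => simp
  | cons a w ih =>
    have ha := h a (by simp)
    interval_cases a
    · rcases ih (fun x hx => h x (by simp [hx])) with h1 | ⟨l, u, h1⟩
      · left
        rw [List.length_cons, List.replicate_succ, ← h1]
      · right
        exact ⟨l + 1, u, by rw [List.replicate_succ, List.cons_append, ← h1]⟩
    · exact Or.inr ⟨0, w, rfl⟩

theorem F_spec (k : ℕ) (hk : 1 ≤ k) (n : ℕ) : (F k n).Nodup ∧ ∀ w : List ℕ, w ∈ F k n ↔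
    w.length = n ∧ (∀ x ∈ w, x < 2) ∧ ¬ List.replicate k 0 <:+: w := by
  induction n using Nat.strong_induction_on with
  | _ n ih =>
    rw [F]
    split_ifs with h
    · refine ⟨C_nodup n, fun w => ?_⟩
      rw [C_mem]
      constructor
      · rintro ⟨h1, h2⟩
        refine ⟨h1, h2, fun h3 => ?_⟩
        have := h3.length_le
        simp at this
        omega
      · tauto
    · constructor
      · rw [List.nodup_flatMap]
        constructor
        · rintro ⟨l, hl⟩ _
          rw [List.mem_range] at hl
          apply List.Nodup.map
          · intro a b hab
            exact (rep_inj _ _ _ _ hab).2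
          · exact List.nodup_reverse.2 (ih _ (by simp only; omega)).1
        · refine List.Pairwise.imp ?_ (List.nodup_attach.2 (List.nodup_range (n := k)))
          intro a b hab
          simp only [Function.onFun, List.disjoint_left, List.mem_map]
          rintro x ⟨u, _, rfl⟩ ⟨v, _, h⟩
          exact hab (Subtype.ext (rep_inj _ _ _ _ h).1.symm)
      · intro w
        simp only [List.mem_flatMap, List.mem_attach, true_and, List.mem_map, List.mem_reverse,
          Subtype.exists, List.mem_range]
        constructor
        · rintro ⟨l, hl, u, hu, rfl⟩
          rw [(ih (n - 1 - l) (by omega)).2] at hu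
          obtain ⟨h1, h2, h3⟩ := hu
          refine ⟨by simp; omega, ?_, by rwa [avoid_iff k l hl]⟩
          intro x hx
          simp only [List.mem_append, List.mem_replicate, List.mem_cons] at hx
          rcases hx with hx | hx | hx
          · omega
          · omega
          · exact h2 x hx
        · rintro ⟨h1, h2, h3⟩
          rcases bin_decomp w h2 with h4 | ⟨l, u, rfl⟩
          · exfalso
            apply h3
            rw [h4, h1, show n = k + (n - k) by omega, List.replicate_add]
            exact (List.prefix_append _ _).isInfix
          · by_cases hl : l < k
            · refine ⟨l, hl, u, ?_, rfl⟩
              rw [avoid_iff k l hl] at h3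
              rw [(ih (n - 1 - l) (by omega)).2]
              refine ⟨?_, fun x hx => h2 x (by simp [hx]), h3⟩
              simp at h1
              omega
            · exfalso
              apply h3
              rw [show l = k + (l - k) by omega, List.replicate_add, List.append_assoc]
              exact (List.prefix_append _ _).isInfix

theorem subst_spec (q : ℕ) (hq : 2 ≤ q) (β : List ℕ) (hβ : ∀ x ∈ β, x < 2) (w : List ℕ)
    (hl : w.length = β.count 1) (hw : ∀ x ∈ w, x ≠ 0 ∧ x < q) :
    trace (subst β w) = β ∧ (∀ x ∈ subst β w, x < q) ∧ (subst β w).filter (· ≠ 0) = w := by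
  induction β generalizing w with
  | nil =>
    simp at hl
    simp [subst, trace, hl]
  | cons b β ih =>
    have hb := hβ b (by simp)
    have hβ' : ∀ x ∈ β, x < 2 := fun x hx => hβ x (by simp [hx])
    interval_cases b
    · obtain ⟨h1, h2, h3⟩ := ih hβ' w (by simpa using hl) hw
      simp only [subst]
      refine ⟨?_, ?_, ?_⟩
      · simpa [trace] using h1
      · simp; exact ⟨by omega, h2⟩
      · simpa using h3
    · cases w with
      | nil => simp at hl
      | cons a w =>
        have ha := hw a (by simp)
        obtain ⟨h1, h2, h3⟩ := ih hβ' w (by simpa using hl) (fun x hx => hw x (by simp [hx]))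
        simp only [subst, List.headD_cons, List.tail_cons]
        refine ⟨?_, ?_, ?_⟩
        · simpa [trace, ha.1] using h1
        · simp; exact ⟨ha.2, h2⟩
        · simpa [ha.1] using h3

theorem subst_trace (w : List ℕ) : subst (trace w) (w.filter (· ≠ 0)) = w ∧
    (w.filter (· ≠ 0)).length = (trace w).count 1 := by
  induction w with
  | nil => simp [trace, subst]
  | cons a w ih =>
    simp only [trace] at ih
    by_cases ha : a = 0
    · subst ha
      simpa [trace, subst] using ih
    · simpa [trace, subst, ha] using ih

theorem expand_spec (q : ℕ) (hq : 2 ≤ q) (β : List ℕ) (hβ : ∀ x ∈ β, x < 2) :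
    (expand q β).Nodup ∧ ∀ w : List ℕ, w ∈ expand q β ↔ trace w = β ∧ ∀ x ∈ w, x < q := by
  constructor
  · apply List.Nodup.map_on _ (G_nodup _ _)
    intro x hx y hy hxy
    rw [G_mem] at hx hy
    rw [← (subst_spec q hq β hβ x hx.1 hx.2).2.2, ← (subst_spec q hq β hβ y hy.1 hy.2).2.2, hxy]
  · intro w
    simp only [expand, List.mem_map, G_mem]
    constructor
    · rintro ⟨u, ⟨h1, h2⟩, rfl⟩
      have := subst_spec q hq β hβ u h1 h2
      exact ⟨this.1, this.2.1⟩
    · rintro ⟨rfl, h2⟩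
      refine ⟨w.filter (· ≠ 0), ⟨(subst_trace w).2, ?_⟩, (subst_trace w).1⟩
      intro x hx
      simp only [ne_eq, decide_not, List.mem_filter, Bool.not_eq_eq_eq_not, Bool.not_true,
        decide_eq_false_iff_not] at hx
      exact ⟨hx.2, h2 x hx.1⟩

theorem H_spec (q k n : ℕ) (hq : 2 ≤ q) (hk : 2 ≤ k) :
    (H q k n).Nodup ∧
    (∀ w : List ℕ, w ∈ H q k n ↔ (∀ x ∈ w, x < q) ∧ ∃ φ ∈ F k (n - 2), trace w = 1 :: (φ ++ [1])) ∧
    (H q k n).Pairwise (fun a b => (F k (n - 2)).idxOf (trace a).tail.dropLast ≤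
      (F k (n - 2)).idxOf (trace b).tail.dropLast) := by
  obtain ⟨hF, hFm⟩ := F_spec k (by omega) (n - 2)
  have hbin : ∀ φ ∈ F k (n - 2), ∀ x ∈ 1 :: (φ ++ [1]), x < 2 := by
    intro φ hφ x hx
    simp only [List.mem_cons, List.mem_append, List.not_mem_nil, or_false] at hx
    rcases hx with hx | hx | hx
    · omega
    · exact ((hFm φ).1 hφ).2.1 x hx
    · omega
  have hz : ∀ p ∈ (F k (n - 2)).zipIdx, p.1 ∈ F k (n - 2) ∧ (F k (n - 2)).idxOf p.1 = p.2 := by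
    rintro ⟨φ, i⟩ hp
    rw [List.mem_zipIdx_iff_getElem?] at hp
    simp only at hp ⊢
    obtain ⟨hi, he⟩ := List.getElem?_eq_some_iff.1 hp
    refine ⟨List.mem_of_getElem? hp, ?_⟩
    rw [← he, hF.idxOf_getElem]
  have hzp : (F k (n - 2)).zipIdx.Pairwise (fun p p' => p.2 < p'.2) := by
    rw [List.pairwise_iff_getElem]
    intro i j hi hj hij
    simpa using hij
  have hmem : ∀ p ∈ (F k (n - 2)).zipIdx, ∀ w, (w ∈ (if p.2 % 2 = 0 then expand q (1 :: (p.1 ++ [1]))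
      else (expand q (1 :: (p.1 ++ [1]))).reverse)) ↔
      trace w = 1 :: (p.1 ++ [1]) ∧ ∀ x ∈ w, x < q := by
    intro p hp w
    rw [← (expand_spec q hq _ (hbin _ (hz p hp).1)).2]
    split_ifs <;> simp
  refine ⟨?_, ?_, ?_⟩
  · rw [H, List.nodup_flatMap]
    constructor
    · intro p hp
      have := (expand_spec q hq _ (hbin _ (hz p hp).1)).1
      split_ifs
      · exact this
      · exact List.nodup_reverse.2 this
    · refine List.Pairwise.imp_of_mem ?_ hzp
      intro p p' hp hp' hlt
      simp only [Function.onFun, List.disjoint_left]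
      intro w h1 h2
      rw [hmem _ hp] at h1
      rw [hmem _ hp'] at h2
      have h3 := h1.1.symm.trans h2.1
      simp at h3
      have := (hz p hp).2
      rw [h3, (hz p' hp').2] at this
      omega
  · intro w
    rw [H, List.mem_flatMap]
    constructor
    · rintro ⟨p, hp, h⟩
      rw [hmem p hp] at h
      exact ⟨h.2, p.1, (hz p hp).1, h.1⟩
    · rintro ⟨h1, φ, hφ, h2⟩
      obtain ⟨i, hi⟩ := List.mem_iff_getElem?.1 hφ
      have hp : (φ, i) ∈ (F k (n - 2)).zipIdx := by
        rw [List.mem_zipIdx_iff_getElem?]; exact hi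
      exact ⟨(φ, i), hp, (hmem _ hp w).2 ⟨h2, h1⟩⟩
  · rw [H, List.pairwise_flatMap]
    constructor
    · intro p hp
      rw [List.pairwise_iff_getElem]
      intro i j hi hj _
      have ha := List.getElem_mem hi
      have hb := List.getElem_mem hj
      rw [hmem p hp] at ha hb
      rw [ha.1, hb.1]
    · refine List.Pairwise.imp_of_mem ?_ hzp
      intro p p' hp hp' hlt a ha b hb
      rw [hmem _ hp] at ha
      rw [hmem _ hp'] at hb
      rw [ha.1, hb.1]
      simp only [List.tail_cons, List.dropLast_concat]
      rw [(hz p hp).2, (hz p' hp').2]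
      omega

theorem trace_infix (k : ℕ) (u : List ℕ) :
    List.replicate k 0 <:+: trace u ↔ List.replicate k 0 <:+: u := by
  constructor
  · intro h
    obtain ⟨s, t, h⟩ := h
    simp only [trace] at h
    symm at h
    rw [List.map_eq_append_iff] at h
    obtain ⟨l1, l2, rfl, h1, h2⟩ := h
    rw [List.map_eq_append_iff] at h1
    obtain ⟨m1, m2, rfl, h3, h4⟩ := h1
    have : m2 = List.replicate k 0 := by
      rw [List.eq_replicate_iff] at h4 ⊢
      refine ⟨by simpa using h4.1, ?_⟩
      intro b hb
      have := h4.2 _ (List.mem_map_of_mem hb)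
      by_contra h0
      simp [h0] at this
    rw [← this]
    exact ⟨m1, l2, rfl⟩
  · intro h
    have := h.map (fun x => if x = 0 then 0 else 1)
    simpa [trace] using this

theorem H_mem (q k n : ℕ) (hq : 2 ≤ q) (hk : 2 ≤ k) (hn : 2 ≤ n) (w : List ℕ) :
    w ∈ H q k n ↔ (∀ x ∈ w, x < q) ∧ ∃ a u b, w = a :: (u ++ [b]) ∧ a ≠ 0 ∧ b ≠ 0 ∧
      u.length = n - 2 ∧ ¬ List.replicate k 0 <:+: u := by
  rw [(H_spec q k n hq hk).2.1]
  refine and_congr_right fun _ => ?_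
  constructor
  · rintro ⟨φ, hφ, h⟩
    rw [(F_spec k (by omega) _).2] at hφ
    rw [trace, List.map_eq_cons_iff] at h
    obtain ⟨a, v, rfl, h1, h2⟩ := h
    rw [List.map_eq_append_iff] at h2
    obtain ⟨u, m, rfl, rfl, h3⟩ := h2
    rw [List.map_eq_singleton_iff] at h3
    obtain ⟨b, rfl, h3⟩ := h3
    refine ⟨a, u, b, rfl, ?_, ?_, by simpa using hφ.1, ?_⟩
    · rintro rfl; simp at h1
    · rintro rfl; simp at h3
    · rw [← trace_infix]; exact hφ.2.2
  · rintro ⟨a, u, b, rfl, ha, hb, hl, hu⟩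
    refine ⟨trace u, ?_, by simp [trace, ha, hb]⟩
    rw [(F_spec k (by omega) _).2, trace_infix]
    refine ⟨by simpa [trace] using hl, ?_, hu⟩
    intro x hx
    simp only [trace, List.mem_map] at hx
    obtain ⟨y, _, rfl⟩ := hx
    split_ifs <;> omega

/-- For every `q ≥ 2`, `n ≥ 4` and `2 ≤ k ≤ n-2`, the list `S_{n,q}^{(k)}` contains exactly
once each word `s_1s_2⋯s_n` over `{0,…,q-1}` with `s_1 = ⋯ = s_k = 0`, `s_{k+1} ≠ 0`,
`s_n ≠ 0` and no `k` consecutive 0's in the subword `s_{k+2}⋯s_{n-1}`, and contains no other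
words.  Moreover, the list is trace partitioned: words with the same trace occupy
consecutive positions in the list. -/
theorem stmt_19 (q k n : ℕ) (hq : 2 ≤ q) (hn : 4 ≤ n) (hk : 2 ≤ k) (hkn : k ≤ n - 2) :
    (∀ w : List ℕ, (S q k n).count w =
      if w.length = n ∧ (∀ x ∈ w, x < q) ∧ w.take k = List.replicate k 0 ∧
         w[k]? ≠ some 0 ∧ w.getLast? ≠ some 0 ∧
         ¬ (List.replicate k 0 <:+: ((w.drop (k + 1)).take (n - k - 2)))
      then 1 else 0) ∧
    (∀ τ : List ℕ, ∀ i j m : ℕ, i ≤ j → j ≤ m →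
      ∀ a b c : List ℕ,
        (S q k n)[i]? = some a → (S q k n)[j]? = some b → (S q k n)[m]? = some c →
        trace a = τ → trace c = τ → trace b = τ) := by
  have hinj : Function.Injective (fun w : List ℕ => List.replicate k 0 ++ w) :=
    fun a b h => List.append_cancel_left h
  obtain ⟨hnd, -, hpw⟩ := H_spec q k (n - k) hq hk
  constructor
  · intro w
    have hSnd : (S q k n).Nodup := List.Nodup.map hinj hnd
    rw [hSnd.count]
    refine if_congr ?_ rfl rfl
    simp only [S, List.mem_map, H_mem q k (n - k) hq hk (by omega)]
    constructor
    · rintro ⟨v, ⟨h1, a, u, b, rfl, ha, hb, hl, hu⟩, rfl⟩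
      refine ⟨by simp; omega, ?_, by simp, by simpa using ha, ?_, ?_⟩
      · intro x hx
        rw [List.mem_append, List.mem_replicate] at hx
        rcases hx with hx | hx
        · omega
        · exact h1 x hx
      · rw [← List.cons_append, ← List.append_assoc, List.getLast?_concat]
        simpa using hb
      · rw [show n - k - 2 = u.length by omega]
        have : List.drop (k + 1) (List.replicate k 0 ++ a :: (u ++ [b])) = u ++ [b] := by
          simp [List.drop_append]
        rw [this, List.take_left]
        exact hu
    · rintro ⟨h1, h2, h3, h4, h5, h6⟩
      have hw : w = List.replicate k 0 ++ w.drop k := by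
        rw [← h3, List.take_append_drop]
      generalize hv : w.drop k = v at hw
      have hvl : v.length = n - k := by rw [← hv]; simp [h1]
      subst hw
      cases v with
      | nil => simp at hvl; omega
      | cons a v =>
        rcases List.eq_nil_or_concat v with rfl | ⟨u, b, rfl⟩
        · simp at hvl; omega
        · simp only [List.concat_eq_append] at *
          have hl : u.length = n - k - 2 := by simp at hvl; omega
          refine ⟨a :: (u ++ [b]), ⟨fun x hx => h2 x (List.mem_append_right _ hx), a, u, b, rfl,
            ?_, ?_, hl, ?_⟩, rfl⟩
          · simpa using h4
          · rw [← List.cons_append, ← List.append_assoc, List.getLast?_concat] at h5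
            simpa using h5
          · have : List.drop (k + 1) (List.replicate k 0 ++ a :: (u ++ [b])) = u ++ [b] := by
              simp [List.drop_append]
            rw [this, ← hl, List.take_left] at h6
            exact h6
  · intro τ i j m hij hjm a b c ha hb hc hta htc
    simp only [S, List.getElem?_map, Option.map_eq_some_iff] at ha hb hc
    obtain ⟨a, ha, rfl⟩ := ha
    obtain ⟨b, hb, rfl⟩ := hb
    obtain ⟨c, hc, rfl⟩ := hc
    have htr : ∀ w, trace (List.replicate k 0 ++ w) = List.replicate k 0 ++ trace w := by
      intro w; simp [trace]
    rw [htr] at hta htc ⊢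
    have hac : trace a = trace c := List.append_cancel_left (hta.trans htc.symm)
    have hle : ∀ (i j : ℕ) (a b : List ℕ), i ≤ j → (H q k (n - k))[i]? = some a → (H q k (n - k))[j]? = some b →
        (F k (n - k - 2)).idxOf (trace a).tail.dropLast ≤
        (F k (n - k - 2)).idxOf (trace b).tail.dropLast := by
      intro i j a b hij ha hb
      obtain ⟨hi, rfl⟩ := List.getElem?_eq_some_iff.1 ha
      obtain ⟨hj, rfl⟩ := List.getElem?_eq_some_iff.1 hb
      rcases hij.eq_or_lt with rfl | hlt
      · exact le_rfl
      · exact (List.pairwise_iff_getElem.1 hpw) i j hi hj hlt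
    have h1 := hle i j a b hij ha hb
    have h2 := hle j m b c hjm hb hc
    rw [← hac] at h2
    have h3 := le_antisymm h1 h2
    obtain ⟨-, φ, hφ, ha'⟩ := ((H_spec q k (n - k) hq hk).2.1 a).1 (List.mem_of_getElem? ha)
    obtain ⟨-, ψ, hψ, hb'⟩ := ((H_spec q k (n - k) hq hk).2.1 b).1 (List.mem_of_getElem? hb)
    rw [ha', hb'] at h3
    simp only [List.tail_cons, List.dropLast_concat] at h3
    have h4 : φ = ψ := (List.idxOf_inj hφ).1 h3
    rw [← hta, ha', hb', h4]
end
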